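/- arXiv:math/0508497 — 8 statements merged into one kernel-verified Lean document; each statement's English description precedes it below -/
import Mathlib

section
/- If G₁ ≠ ∅, then every G-equivariant functional T : 𝒫 → Θ satisfies ε*(T, P, d, D) ≤ (1 − Δ(P))/2 for every P ∈ 𝒫, every admissible pseudometric d on 𝒫 and every pseudometric D on Θ with sup_{θ₁,θ₂∈Θ} D(θ₁,θ₂) = ∞. -/
open MeasureTheory Filter Set
open scoped NNReal ENNReal

theorem aux_dist {X : Type*} [MeasurableSpace X]
    (d : Measure X → Measure X → ℝ)
    (hd_self : ∀ P : Measure X, IsProbabilityMeasure P → d P P = 0)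
    (hd_convex : ∀ (P Q₁ Q₂ : Measure X), IsProbabilityMeasure P →
      IsProbabilityMeasure Q₁ → IsProbabilityMeasure Q₂ → ∀ α : ℝ≥0, 0 < α → α < 1 →
      d ((α : ℝ≥0∞) • P + ((1 - α : ℝ≥0) : ℝ≥0∞) • Q₁)
        ((α : ℝ≥0∞) • P + ((1 - α : ℝ≥0) : ℝ≥0∞) • Q₂) ≤ 1 - (α : ℝ))
    (μ ρ ν : Measure X) (m : ℝ≥0) (hμ : μ univ + m = 1)
    (hρ : ρ univ = m) (hν : ν univ = m) :
    d (μ + ρ) (μ + (2⁻¹ : ℝ≥0) • ρ + (2⁻¹ : ℝ≥0) • ν) ≤ (m : ℝ) / 2 := by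
  have hμρ : IsProbabilityMeasure (μ + ρ) := ⟨by simp [hρ, hμ]⟩
  by_cases hm : m = 0
  · subst hm
    have h1 : ρ = 0 := by simpa using hρ
    have h2 : ν = 0 := by simpa using hν
    subst h1; subst h2
    simp only [smul_zero, add_zero] at hμρ ⊢
    simp [hd_self μ hμρ]
  have hm1 : m ≤ 1 := by
    have : (m : ℝ≥0∞) ≤ 1 := hμ ▸ le_add_self
    exact_mod_cast this
  have hm0 : 0 < m := pos_iff_ne_zero.mpr hm
  obtain ⟨α, hα⟩ : ∃ α : ℝ≥0, α + m / 2 = 1 :=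
    ⟨1 - m / 2, tsub_add_cancel_of_le ((half_le_self m.2).trans hm1)⟩
  have hα' : 1 - α = m / 2 := by rw [← hα]; simp
  have hαR : (α : ℝ) + m / 2 = 1 := by exact_mod_cast hα
  have hm1R : (m : ℝ) ≤ 1 := hm1
  have hm0R : (0 : ℝ) < m := hm0
  have hα0 : 0 < α := by
    rw [← NNReal.coe_pos]; linarith
  have hα1 : α < 1 := by
    rw [← NNReal.coe_lt_coe]; push_cast; linarith
  obtain ⟨b, hb⟩ : ∃ b : ℝ≥0, μ univ = b := by
    have : μ univ ≠ ⊤ := ne_top_of_le_ne_top ENNReal.one_ne_top (hμ ▸ le_self_add)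
    exact ⟨(μ univ).toNNReal, (ENNReal.coe_toNNReal this).symm⟩
  have hbm : b + m = 1 := by
    rw [hb] at hμ; exact_mod_cast hμ
  have hbα : b + 2⁻¹ * m = α := by
    have hbR : (b : ℝ) + m = 1 := by exact_mod_cast hbm
    rw [← NNReal.coe_inj]; push_cast; linarith
  have hR : IsProbabilityMeasure (α⁻¹ • (μ + (2⁻¹ : ℝ≥0) • ρ)) := ⟨by
    simp only [Measure.smul_apply, Measure.add_apply, hb, hρ, ENNReal.smul_def, smul_eq_mul]
    rw [← ENNReal.coe_mul, ← ENNReal.coe_add, ← ENNReal.coe_mul, hbα,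
      inv_mul_cancel₀ hα0.ne', ENNReal.coe_one]⟩
  have hS : ∀ κ : Measure X, κ univ = m → IsProbabilityMeasure (m⁻¹ • κ) := fun κ hκ => ⟨by
    simp only [Measure.smul_apply, hκ, ENNReal.smul_def, smul_eq_mul]
    rw [← ENNReal.coe_mul, inv_mul_cancel₀ hm, ENNReal.coe_one]⟩
  have key := hd_convex _ _ _ hR (hS ρ hρ) (hS ν hν) α hα0 hα1
  have hc : ∀ κ : Measure X, (α : ℝ≥0∞) • (α⁻¹ • (μ + (2⁻¹ : ℝ≥0) • ρ))
      + ((1 - α : ℝ≥0) : ℝ≥0∞) • (m⁻¹ • κ) = μ + (2⁻¹ : ℝ≥0) • ρ + (2⁻¹ : ℝ≥0) • κ := by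
    intro κ
    change α • (α⁻¹ • (μ + (2⁻¹ : ℝ≥0) • ρ)) + (1 - α) • (m⁻¹ • κ) = _
    rw [smul_smul, smul_smul, mul_inv_cancel₀ hα0.ne', one_smul, hα']
    congr 2
    field_simp
  rw [hc, hc, add_assoc μ, ← add_smul] at key
  have h21 : (2⁻¹ : ℝ≥0) + 2⁻¹ = 1 := by
    rw [← NNReal.coe_inj]; push_cast; norm_num
  rw [h21, one_smul] at key
  linarith

theorem aux_map_fix {X : Type*} [MeasurableSpace X] (P : Measure X) (B : Set X)
    (hB : MeasurableSet B) (f : X → X) (hf : ∀ x ∈ B, f x = x) :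
    Measure.map f (P.restrict B) = P.restrict B := by
  rw [Measure.map_congr (g := id), Measure.map_id]
  exact (ae_restrict_iff' hB).mpr (Eventually.of_forall hf)

/-- **Breakdown and groups, Theorem 3.1** (Davies–Gather).
If `G₁ ≠ ∅`, every `G`-equivariant functional `T : 𝒫 → Θ` has breakdown point
at most `(1 − Δ(P))/2` at every probability measure `P`, for every admissible
pseudometric `d` on `𝒫` and every unbounded pseudometric `D` on `Θ`. -/
theorem breakdown_le_of_equivariant
    {X : Type*} [MeasurableSpace X] {Θ : Type*} [Nonempty Θ]
    -- a group `G` of bimeasurable bijections of `X`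
    (G : Subgroup (Equiv.Perm X))
    (hGmeas : ∀ g : G, Measurable ⇑(g : Equiv.Perm X) ∧ Measurable ⇑((g : Equiv.Perm X)⁻¹))
    -- a homomorphism `g ↦ h_g` into the bijections of `Θ`
    (h : G →* Equiv.Perm Θ)
    -- `D` is a pseudometric on `Θ` with supremum `∞`
    (D : Θ → Θ → ℝ)
    (hD_self : ∀ θ, D θ θ = 0) (hD_nonneg : ∀ θ₁ θ₂, 0 ≤ D θ₁ θ₂)
    (hD_symm : ∀ θ₁ θ₂, D θ₁ θ₂ = D θ₂ θ₁)
    (hD_tri : ∀ θ₁ θ₂ θ₃, D θ₁ θ₃ ≤ D θ₁ θ₂ + D θ₂ θ₃)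
    (hD_unbdd : ∀ M : ℝ, ∃ θ₁ θ₂, M < D θ₁ θ₂)
    -- `d` is an admissible pseudometric on the probability measures on `X`
    (d : Measure X → Measure X → ℝ)
    (hd_self : ∀ P : Measure X, IsProbabilityMeasure P → d P P = 0)
    (hd_nonneg : ∀ P Q : Measure X, IsProbabilityMeasure P → IsProbabilityMeasure Q →
      0 ≤ d P Q)
    (hd_symm : ∀ P Q : Measure X, IsProbabilityMeasure P → IsProbabilityMeasure Q →
      d P Q = d Q P)
    (hd_tri : ∀ P Q R : Measure X, IsProbabilityMeasure P → IsProbabilityMeasure Q →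
      IsProbabilityMeasure R → d P R ≤ d P Q + d Q R)
    (hd_sup_one : IsLUB {r : ℝ | ∃ P Q : Measure X,
      IsProbabilityMeasure P ∧ IsProbabilityMeasure Q ∧ r = d P Q} 1)
    (hd_convex : ∀ (P Q₁ Q₂ : Measure X), IsProbabilityMeasure P →
      IsProbabilityMeasure Q₁ → IsProbabilityMeasure Q₂ → ∀ α : ℝ≥0, 0 < α → α < 1 →
      d ((α : ℝ≥0∞) • P + ((1 - α : ℝ≥0) : ℝ≥0∞) • Q₁)
        ((α : ℝ≥0∞) • P + ((1 - α : ℝ≥0) : ℝ≥0∞) • Q₂) ≤ 1 - (α : ℝ))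
    -- the set `G₁`
    (G₁ : Set G)
    (hG₁ : G₁ = {g : G | Tendsto (fun n : ℕ => ⨅ θ : Θ, D θ (h (g ^ n) θ)) atTop atTop})
    (hG₁_ne : G₁.Nonempty)
    -- a `G`-equivariant functional `T`
    (T : Measure X → Θ)
    (hT_equiv : ∀ (g : G) (P : Measure X), IsProbabilityMeasure P →
      T (Measure.map ⇑(g : Equiv.Perm X) P) = h g (T P))
    -- the functional `Δ`
    (Δ : Measure X → ℝ)
    (hΔ : ∀ P : Measure X, Δ P = sSup {r : ℝ | ∃ B : Set X, MeasurableSet B ∧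
      (∃ g ∈ G₁, ∀ x ∈ B, (g : Equiv.Perm X) x = x) ∧ r = (P B).toReal})
    -- the breakdown point
    (P : Measure X) (hP : IsProbabilityMeasure P) :
    sInf {ε : ℝ | 0 < ε ∧ ∀ M : ℝ, ∃ Q : Measure X, IsProbabilityMeasure Q ∧
        d P Q < ε ∧ M < D (T P) (T Q)} ≤ (1 - Δ P) / 2 := by
  classical
  set S : Set ℝ := {r : ℝ | ∃ B : Set X, MeasurableSet B ∧
      (∃ g ∈ G₁, ∀ x ∈ B, (g : Equiv.Perm X) x = x) ∧ r = (P B).toReal} with hS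
  have hSne : S.Nonempty := by
    obtain ⟨g, hg⟩ := hG₁_ne
    exact ⟨0, ∅, MeasurableSet.empty, ⟨g, hg, by simp⟩, by simp⟩
  have hS1 : ∀ r ∈ S, r ≤ 1 := by
    rintro r ⟨B, -, -, rfl⟩
    exact ENNReal.toReal_mono ENNReal.one_ne_top prob_le_one
  have hΔP : Δ P = sSup S := hΔ P
  have hΔ1 : Δ P ≤ 1 := hΔP ▸ csSup_le hSne hS1
  refine le_of_forall_gt_imp_ge_of_dense fun ε hε => ?_
  have hε0 : 0 < ε := by linarith
  refine csInf_le ⟨0, fun x hx => hx.1.le⟩ ⟨hε0, fun M => ?_⟩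
  obtain ⟨r, ⟨B, hB, ⟨g, hg, hgB⟩, rfl⟩, hr⟩ :=
    exists_lt_of_lt_csSup hSne (show 1 - 2 * ε < sSup S by linarith)
  rw [hG₁] at hg
  obtain ⟨n, hn⟩ := (hg.eventually_gt_atTop (2 * M)).exists
  have hn' : ∀ θ, 2 * M < D θ (h (g ^ n) θ) := fun θ =>
    hn.trans_le (ciInf_le ⟨0, by rintro _ ⟨θ, rfl⟩; exact hD_nonneg _ _⟩ θ)
  set k : G := g ^ n with hk
  have hkB : ∀ x ∈ B, (k : Equiv.Perm X) x = x := by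
    intro x hx
    have : Function.IsFixedPt (⇑(g : Equiv.Perm X)) x := hgB x hx
    have h2 := this.iterate n
    rw [← Equiv.Perm.coe_pow] at h2
    exact h2
  have hkm := (hGmeas k).1
  have hkm' := (hGmeas k).2
  have hkB' : ∀ x ∈ B, ((k : Equiv.Perm X)⁻¹) x = x := fun x hx => by
    rw [Equiv.Perm.inv_eq_iff_eq]; exact (hkB x hx).symm
  set ρ := P.restrict Bᶜ with hρ
  set μ := P.restrict B with hμ
  have hsum : μ + ρ = P := Measure.restrict_add_restrict_compl hB
  obtain ⟨m, hm⟩ : ∃ m : ℝ≥0, P Bᶜ = m :=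
    ⟨(P Bᶜ).toNNReal, (ENNReal.coe_toNNReal (measure_ne_top _ _)).symm⟩
  have hbm : P B + m = 1 := by rw [← hm, prob_add_prob_compl hB]
  have hμu : μ univ + m = 1 := by simpa [hμ] using hbm
  have hρu : ρ univ = m := by simpa [hρ] using hm
  have hmε : (m : ℝ) / 2 < ε := by
    have := congrArg ENNReal.toReal hbm
    rw [ENNReal.toReal_add (measure_ne_top _ _) ENNReal.coe_ne_top] at this
    simp at this
    linarith
  set Q := μ + (2⁻¹ : ℝ≥0) • ρ + (2⁻¹ : ℝ≥0) • Measure.map ⇑(k : Equiv.Perm X) ρ with hQ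
  set Q' := μ + (2⁻¹ : ℝ≥0) • ρ + (2⁻¹ : ℝ≥0) • Measure.map ⇑((k : Equiv.Perm X)⁻¹) ρ with hQ'
  have hu : ∀ f : X → X, Measurable f → Measure.map f ρ univ = m := fun f hf => by
    rw [Measure.map_apply hf MeasurableSet.univ, preimage_univ, hρu]
  have hprob : ∀ f : X → X, Measurable f → IsProbabilityMeasure
      (μ + (2⁻¹ : ℝ≥0) • ρ + (2⁻¹ : ℝ≥0) • Measure.map f ρ) := fun f hf => ⟨by
    have h21 : (2⁻¹ : ℝ≥0) + 2⁻¹ = 1 := by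
      rw [← NNReal.coe_inj]; push_cast; norm_num
    simp only [Measure.add_apply, Measure.smul_apply, hu f hf, hρu]
    rw [add_assoc, ← add_smul, h21, one_smul, hμu]⟩
  have hdist : ∀ f : X → X, Measurable f →
      d P (μ + (2⁻¹ : ℝ≥0) • ρ + (2⁻¹ : ℝ≥0) • Measure.map f ρ) < ε := fun f hf => by
    have := aux_dist d hd_self hd_convex μ ρ (Measure.map f ρ) m hμu hρu (hu f hf)
    rw [hsum] at this
    linarith
  have hmap : Measure.map ⇑(k : Equiv.Perm X) Q' = Q := by
    rw [hQ', Measure.map_add _ _ hkm, Measure.map_add _ _ hkm, Measure.map_smul,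
      Measure.map_smul, Measure.map_map hkm hkm', aux_map_fix P B hB _ hkB]
    have : ⇑(k : Equiv.Perm X) ∘ ⇑((k : Equiv.Perm X)⁻¹) = id := by
      ext x; simp
    rw [this, Measure.map_id, hQ, add_right_comm]
  have hTQ : T Q = h k (T Q') := by
    rw [← hmap]; exact hT_equiv k Q' (hprob _ hkm')
  by_contra hcon
  push Not at hcon
  have h1 := hcon Q (hprob _ hkm) (hdist _ hkm)
  have h2 := hcon Q' (hprob _ hkm') (hdist _ hkm')
  have h3 := hn' (T Q')
  rw [← hTQ] at h3
  have h4 := hD_tri (T Q') (T P) (T Q)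
  rw [hD_symm (T Q') (T P)] at h4
  linarith
end

section
/- If G₁ ≠ ∅, then for every G-equivariant functional T defined on empirical measures of samples of size n in 𝒳 and every sample x_n, with k = ⌊(n − nΔ(P_n) + 1)/2⌋ one has sup over k-replacement samples y of D(T(P_n), T(Q_y)) = ∞; consequently fsbp(T, x_n, D) ≤ ⌊(n − nΔ(P_n) + 1)/2⌋ / n. -/
open MeasureTheory Filter Set
open scoped NNReal ENNReal

/-- The empirical measure of a sample of size `n`. -/
noncomputable def empiricalMeasure {X : Type*} [MeasurableSpace X] {n : ℕ}
    (x : Fin n → X) : Measure X :=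
  ((n : ℝ≥0∞))⁻¹ • ∑ i : Fin n, Measure.dirac (x i)

lemma empirical_toReal {X : Type*} [MeasurableSpace X] {n : ℕ}
    (x : Fin n → X) (B : Set X) (hB : MeasurableSet B) :
    ∃ F : Finset (Fin n), (∀ i, i ∈ F ↔ x i ∈ B) ∧
      (empiricalMeasure x B).toReal = (F.card : ℝ) / n := by
  classical
  refine ⟨Finset.univ.filter (fun i => x i ∈ B), by simp, ?_⟩
  have h1 : empiricalMeasure x B = (n : ℝ≥0∞)⁻¹ *
      ((Finset.univ.filter (fun i => x i ∈ B)).card : ℝ≥0∞) := by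
    simp [empiricalMeasure, Measure.dirac_apply' _ hB, Set.indicator_apply]
  rw [h1, ENNReal.toReal_mul, ENNReal.toReal_inv, ENNReal.toReal_natCast, ENNReal.toReal_natCast]
  ring

/-- **Breakdown and groups, Theorem 3.2** (Davies–Gather).
If `G₁ ≠ ∅`, then for every `G`-equivariant functional `T` on empirical measures and
every sample `x`, taking `k = ⌊(n − nΔ(Pₙ) + 1)/2⌋`, the supremum of
`D(T(Pₙ), T(Q_y))` over `k`-replacement samples `y` is `∞`; hence
`fsbp(T, x, D) ≤ ⌊(n − nΔ(Pₙ) + 1)/2⌋ / n`. -/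
theorem fsbp_le_of_equivariant
    {X : Type*} [MeasurableSpace X] {Θ : Type*} [Nonempty Θ]
    -- a group `G` of bimeasurable bijections of `X`
    (G : Subgroup (Equiv.Perm X))
    (hGmeas : ∀ g : G, Measurable ⇑(g : Equiv.Perm X) ∧ Measurable ⇑((g : Equiv.Perm X)⁻¹))
    -- a homomorphism `g ↦ h_g` into the bijections of `Θ`
    (h : G →* Equiv.Perm Θ)
    -- `D` is a pseudometric on `Θ` with supremum `∞`
    (D : Θ → Θ → ℝ)
    (hD_self : ∀ θ, D θ θ = 0) (hD_nonneg : ∀ θ₁ θ₂, 0 ≤ D θ₁ θ₂)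
    (hD_symm : ∀ θ₁ θ₂, D θ₁ θ₂ = D θ₂ θ₁)
    (hD_tri : ∀ θ₁ θ₂ θ₃, D θ₁ θ₃ ≤ D θ₁ θ₂ + D θ₂ θ₃)
    (hD_unbdd : ∀ M : ℝ, ∃ θ₁ θ₂, M < D θ₁ θ₂)
    -- the set `G₁`, assumed nonempty
    (G₁ : Set G)
    (hG₁ : G₁ = {g : G | Tendsto (fun m : ℕ => ⨅ θ : Θ, D θ (h (g ^ m) θ)) atTop atTop})
    (hG₁_ne : G₁.Nonempty)
    -- the functional `Δ`
    (Δ : Measure X → ℝ)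
    (hΔ : ∀ P : Measure X, Δ P = sSup {r : ℝ | ∃ B : Set X, MeasurableSet B ∧
      (∃ g ∈ G₁, ∀ x ∈ B, (g : Equiv.Perm X) x = x) ∧ r = (P B).toReal})
    -- a `G`-equivariant functional `T` defined on empirical measures
    (n : ℕ) (hn : 0 < n)
    (T : Measure X → Θ)
    (hT_equiv : ∀ (g : G) (x : Fin n → X),
      T (empiricalMeasure (fun i => (g : Equiv.Perm X) (x i))) = h g (T (empiricalMeasure x)))
    -- the sample
    (x : Fin n → X) :
    (∀ M : ℝ, ∃ y : Fin n → X,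
      {i | y i ≠ x i}.ncard ≤
        ⌊((n : ℝ) - n * Δ (empiricalMeasure x) + 1) / 2⌋₊ ∧
      M < D (T (empiricalMeasure x)) (T (empiricalMeasure y))) ∧
    ((sInf {k : ℕ | ∀ M : ℝ, ∃ y : Fin n → X,
        {i | y i ≠ x i}.ncard ≤ k ∧
        M < D (T (empiricalMeasure x)) (T (empiricalMeasure y))} : ℕ) : ℝ) / n ≤
      (⌊((n : ℝ) - n * Δ (empiricalMeasure x) + 1) / 2⌋₊ : ℝ) / n := by
  classical
  have key : ∀ M : ℝ, ∃ y : Fin n → X,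
      {i | y i ≠ x i}.ncard ≤
        ⌊((n : ℝ) - n * Δ (empiricalMeasure x) + 1) / 2⌋₊ ∧
      M < D (T (empiricalMeasure x)) (T (empiricalMeasure y)) := by
    intro M
    have hn' : (0 : ℝ) < n := by exact_mod_cast hn
    -- the supremum is attained
    have hmem : Δ (empiricalMeasure x) ∈ {r : ℝ | ∃ B : Set X, MeasurableSet B ∧
      (∃ g ∈ G₁, ∀ x ∈ B, (g : Equiv.Perm X) x = x) ∧ r = (empiricalMeasure x B).toReal} := by
      rw [hΔ]
      apply Set.Nonempty.csSup_mem
      · obtain ⟨g, hg⟩ := hG₁_ne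
        exact ⟨_, ∅, MeasurableSet.empty, ⟨g, hg, by simp⟩, rfl⟩
      · apply (Set.finite_range (fun F : Finset (Fin n) => (F.card : ℝ) / n)).subset
        rintro r ⟨B, hB, -, rfl⟩
        obtain ⟨F, -, hF⟩ := empirical_toReal x B hB
        exact ⟨F, hF.symm⟩
    obtain ⟨B, hB, ⟨g, hg, hfix⟩, hΔB⟩ := hmem
    obtain ⟨F, hF, hcard⟩ := empirical_toReal x B hB
    have hk : ((n : ℝ) - n * Δ (empiricalMeasure x) + 1) / 2 = (((Fᶜ.card + 1 : ℕ)) : ℝ) / (2 : ℕ) := by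
      rw [hΔB, hcard, mul_div_cancel₀ _ hn'.ne']
      have : F.card + Fᶜ.card = n := by rw [Finset.card_add_card_compl]; simp
      have : (F.card : ℝ) + Fᶜ.card = n := by exact_mod_cast this
      push_cast
      linarith
    rw [hk, Nat.floor_div_natCast, Nat.floor_natCast]
    obtain ⟨C, hCF, hC⟩ := Finset.exists_subset_card_eq
      (show Fᶜ.card / 2 ≤ Fᶜ.card from Nat.div_le_self _ _)
    have hCd : (Fᶜ \ C).card = Fᶜ.card - Fᶜ.card / 2 := by
      rw [Finset.card_sdiff_of_subset hCF, hC]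
    have hg' := hg
    rw [hG₁] at hg'
    obtain ⟨m, hm⟩ := (hg'.eventually_gt_atTop (M + M)).exists
    have hfixm : ∀ i ∈ F, ((g ^ m : G) : Equiv.Perm X) (x i) = x i := by
      intro i hi
      have h1 := hfix _ ((hF i).1 hi)
      rw [Subgroup.coe_pow]
      exact Equiv.Perm.pow_apply_eq_self_of_apply_eq_self h1 m
    -- the two samples
    let z : Fin n → X := fun i =>
      if i ∈ Fᶜ \ C then (((g ^ m : G) : Equiv.Perm X)⁻¹) (x i) else x i
    let y : Fin n → X := fun i => ((g ^ m : G) : Equiv.Perm X) (z i)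
    have hz : {i | z i ≠ x i} ⊆ ((Fᶜ \ C : Finset (Fin n)) : Set (Fin n)) := by
      intro i hi
      by_contra hc
      exact hi (if_neg hc)
    have hy : {i | y i ≠ x i} ⊆ (C : Set (Fin n)) := by
      intro i hi
      by_contra hc
      apply hi
      have hc' : i ∉ C := hc
      by_cases hiF : i ∈ F
      · have : z i = x i := if_neg (by simp [hiF])
        simp only [y, this]
        exact hfixm i hiF
      · have : z i = (((g ^ m : G) : Equiv.Perm X)⁻¹) (x i) := if_pos (by simp [hiF, hc'])
        simp only [y, this]
        exact Equiv.apply_symm_apply _ _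
    have hzc := Set.ncard_le_ncard hz (Finset.finite_toSet _)
    have hyc := Set.ncard_le_ncard hy (Finset.finite_toSet _)
    rw [Set.ncard_coe_finset] at hzc hyc
    have hTy : T (empiricalMeasure y) = h (g ^ m) (T (empiricalMeasure z)) := hT_equiv (g ^ m) z
    have hlt : M + M < D (T (empiricalMeasure z)) (T (empiricalMeasure y)) := by
      rw [hTy]
      refine lt_of_lt_of_le hm (ciInf_le ⟨0, ?_⟩ _)
      rintro _ ⟨θ, rfl⟩
      exact hD_nonneg _ _
    have htri := hD_tri (T (empiricalMeasure z)) (T (empiricalMeasure x)) (T (empiricalMeasure y))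
    rw [hD_symm (T (empiricalMeasure z)) (T (empiricalMeasure x))] at htri
    by_cases hM : M < D (T (empiricalMeasure x)) (T (empiricalMeasure y))
    · exact ⟨y, by omega, hM⟩
    · exact ⟨z, by omega, by linarith⟩
  refine ⟨key, ?_⟩
  gcongr
  exact Nat.sInf_le key
end

section
/- Let P be a probability measure on (𝒳, ℬ), let g be a bimeasurable bijection of 𝒳 and B₀ ∈ ℬ with g(x) = x for all x ∈ B₀. Define the measures Q₁(B) = P(B ∩ B₀), Q₂ = P − Q₁ and, for each n ≥ 1, Q_n = (Q₂ + Q₂^{gⁿ})/2 + Q₁. Then Q₁^g = Q₁ (hence Q₁^{g^{−n}} = Q₁ for all n), and for every admissible pseudometric d on 𝒫 both d(Q_n, P) ≤ (1 − P(B₀))/2 and d(Q_n^{g^{−n}}, P) ≤ (1 − P(B₀))/2 hold for all n. -/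
open MeasureTheory Filter Set
open scoped NNReal ENNReal


theorem bc_aux {X : Type*} [MeasurableSpace X] (d : Measure X → Measure X → ℝ)
    (h0 : ∀ R : Measure X, IsProbabilityMeasure R → d R R = 0)
    (hadm : ∀ (R S₁ S₂ : Measure X), IsProbabilityMeasure R →
        IsProbabilityMeasure S₁ → IsProbabilityMeasure S₂ → ∀ α : ℝ≥0, 0 < α → α < 1 →
        d ((α : ℝ≥0∞) • R + ((1 - α : ℝ≥0) : ℝ≥0∞) • S₁)
          ((α : ℝ≥0∞) • R + ((1 - α : ℝ≥0) : ℝ≥0∞) • S₂) ≤ 1 - (α : ℝ))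
    (A C₁ C₂ : Measure X) (α : ℝ≥0) (hα : 0 < α) (hα1 : α ≤ 1)
    (hA : A univ = α) (hC₁ : C₁ univ = ((1 - α : ℝ≥0) : ℝ≥0∞))
    (hC₂ : C₂ univ = ((1 - α : ℝ≥0) : ℝ≥0∞)) :
    d (A + C₁) (A + C₂) ≤ 1 - (α : ℝ) := by
  have key : ∀ (c : ℝ≥0) (M : Measure X), 0 < c → M univ = c →
      IsProbabilityMeasure ((c : ℝ≥0∞)⁻¹ • M) ∧ (c : ℝ≥0∞) • ((c : ℝ≥0∞)⁻¹ • M) = M := by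
    intro c M hc hM
    have hc0 : (c : ℝ≥0∞) ≠ 0 := by exact_mod_cast hc.ne'
    refine ⟨⟨?_⟩, ?_⟩
    · simp [hM, ENNReal.inv_mul_cancel hc0 ENNReal.coe_ne_top]
    · rw [smul_smul, ENNReal.mul_inv_cancel hc0 ENNReal.coe_ne_top, one_smul]
  rcases hα1.lt_or_eq with h | h
  · have h' : 0 < 1 - α := tsub_pos_of_lt h
    obtain ⟨a1, a2⟩ := key α A hα hA
    obtain ⟨b1, b2⟩ := key _ C₁ h' hC₁
    obtain ⟨c1, c2⟩ := key _ C₂ h' hC₂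
    have := hadm _ _ _ a1 b1 c1 α hα h
    rwa [a2, b2, c2] at this
  · subst h
    have e1 : C₁ = 0 := by simpa using hC₁
    have e2 : C₂ = 0 := by simpa using hC₂
    subst e1 e2
    have : IsProbabilityMeasure A := ⟨by simpa using hA⟩
    simp [h0 A this]

theorem bc_map {X : Type*} [MeasurableSpace X] (P : Measure X) (B₀ : Set X)
    (hB₀ : MeasurableSet B₀) (g : X → X) (hg : Measurable g)
    (hfix : ∀ x ∈ B₀, g x = x) :
    Measure.map g (P.restrict B₀) = P.restrict B₀ := by
  ext B hB
  rw [Measure.map_apply hg hB, Measure.restrict_apply (hg hB), Measure.restrict_apply hB]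
  congr 1
  ext x
  constructor
  · rintro ⟨h1, h2⟩
    exact ⟨by simpa [hfix x h2] using h1, h2⟩
  · rintro ⟨h1, h2⟩
    exact ⟨by simpa [hfix x h2] using h1, h2⟩

/-- **Davies–Gather, key construction in the proof of Theorem 3.1.**
With `Q₁(B) = P(B ∩ B₀)`, `Q₂ = P − Q₁` and `Q_n = (Q₂ + Q₂^{gⁿ})/2 + Q₁`, one has
`Q₁^g = Q₁` (hence `Q₁^{g^{−n}} = Q₁`), and for every admissible pseudometric `d`,
`d(Q_n, P) ≤ (1 − P(B₀))/2` and `d(Q_n^{g^{−n}}, P) ≤ (1 − P(B₀))/2` for all `n`. -/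
theorem breakdown_construction
    {X : Type*} [MeasurableSpace X]
    (P : Measure X) (hP : IsProbabilityMeasure P)
    -- a bimeasurable bijection `g` fixing `B₀` pointwise
    (g : Equiv.Perm X) (hg : Measurable ⇑g) (hg' : Measurable ⇑g⁻¹)
    (B₀ : Set X) (hB₀ : MeasurableSet B₀) (hfix : ∀ x ∈ B₀, g x = x)
    -- the measures `Q₁`, `Q₂` and `Q_n`
    (Q₁ Q₂ : Measure X) (Qn : ℕ → Measure X)
    (hQ₁ : ∀ B : Set X, MeasurableSet B → Q₁ B = P (B ∩ B₀))
    (hQ₂ : Q₂ = P - Q₁)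
    (hQn : ∀ n : ℕ, Qn n =
      ((2 : ℝ≥0∞))⁻¹ • (Q₂ + Measure.map ⇑(g ^ n) Q₂) + Q₁) :
    -- `Q₁` is `g`-invariant
    Measure.map ⇑g Q₁ = Q₁ ∧
    (∀ n : ℕ, Measure.map ⇑(g⁻¹ ^ n) Q₁ = Q₁) ∧
    -- and the distance bounds hold for every admissible pseudometric `d`
    ∀ d : Measure X → Measure X → ℝ,
      (∀ R : Measure X, IsProbabilityMeasure R → d R R = 0) →
      (∀ R S : Measure X, IsProbabilityMeasure R → IsProbabilityMeasure S → 0 ≤ d R S) →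
      (∀ R S : Measure X, IsProbabilityMeasure R → IsProbabilityMeasure S →
        d R S = d S R) →
      (∀ R S U : Measure X, IsProbabilityMeasure R → IsProbabilityMeasure S →
        IsProbabilityMeasure U → d R U ≤ d R S + d S U) →
      IsLUB {r : ℝ | ∃ R S : Measure X,
        IsProbabilityMeasure R ∧ IsProbabilityMeasure S ∧ r = d R S} 1 →
      (∀ (R S₁ S₂ : Measure X), IsProbabilityMeasure R →
        IsProbabilityMeasure S₁ → IsProbabilityMeasure S₂ → ∀ α : ℝ≥0, 0 < α → α < 1 →
        d ((α : ℝ≥0∞) • R + ((1 - α : ℝ≥0) : ℝ≥0∞) • S₁)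
          ((α : ℝ≥0∞) • R + ((1 - α : ℝ≥0) : ℝ≥0∞) • S₂) ≤ 1 - (α : ℝ)) →
      ∀ n : ℕ,
        d (Qn n) P ≤ (1 - (P B₀).toReal) / 2 ∧
        d (Measure.map ⇑(g⁻¹ ^ n) (Qn n)) P ≤ (1 - (P B₀).toReal) / 2 := by
  have e1 : Q₁ = P.restrict B₀ := by
    ext B hB
    rw [hQ₁ B hB, Measure.restrict_apply hB]
  have e2 : Q₂ = P.restrict B₀ᶜ := by
    rw [hQ₂, e1]
    have h := Measure.restrict_add_restrict_compl (μ := P) hB₀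
    ext B hB
    rw [Measure.sub_apply hB Measure.restrict_le_self]
    conv_lhs => rw [← h]
    rw [Measure.add_apply, h]
    exact ENNReal.add_sub_cancel_left (measure_ne_top _ _)
  have hmeas : ∀ n : ℕ, Measurable ⇑(g ^ n) := by
    intro n
    rw [Equiv.Perm.coe_pow]
    exact hg.iterate n
  have hmeas' : ∀ n : ℕ, Measurable ⇑(g⁻¹ ^ n) := by
    intro n
    rw [Equiv.Perm.coe_pow]
    exact hg'.iterate n
  have hfix' : ∀ x ∈ B₀, g⁻¹ x = x := by
    intro x hx
    rw [Equiv.Perm.inv_eq_iff_eq]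
    exact (hfix x hx).symm
  have hinv : ∀ n : ℕ, Measure.map ⇑(g⁻¹ ^ n) Q₁ = Q₁ := by
    intro n
    rw [e1]
    refine bc_map P B₀ hB₀ _ (hmeas' n) ?_
    intro x hx
    rw [Equiv.Perm.coe_pow]
    exact Function.iterate_fixed (hfix' x hx) n
  refine ⟨by rw [e1]; exact bc_map P B₀ hB₀ _ hg hfix, hinv, ?_⟩
  intro d h0 _ _ _ _ hadm n
  have hsum : Q₁ + Q₂ = P := by
    rw [e1, e2]; exact Measure.restrict_add_restrict_compl hB₀
  have hhalf : (2 : ℝ≥0∞)⁻¹ • Q₂ + (2 : ℝ≥0∞)⁻¹ • Q₂ = Q₂ := by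
    rw [← add_smul, ENNReal.inv_two_add_inv_two, one_smul]
  obtain ⟨p, hp⟩ : ∃ p : ℝ≥0, P B₀ = p := ⟨(P B₀).toNNReal, by simp⟩
  have hp1 : p ≤ 1 := by
    have : P B₀ ≤ 1 := prob_le_one
    rw [hp] at this
    exact_mod_cast this
  have m1 : Q₁ univ = (p : ℝ≥0∞) := by rw [e1]; simp [hp]
  have m2 : Q₂ univ = ((1 - p : ℝ≥0) : ℝ≥0∞) := by
    rw [e2, Measure.restrict_apply_univ, prob_compl_eq_one_sub hB₀, hp]
    simp
  have i2 : (2 : ℝ≥0∞)⁻¹ = ((2⁻¹ : ℝ≥0) : ℝ≥0∞) := by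
    rw [ENNReal.coe_inv two_ne_zero]; rfl
  have aux : ∀ T : Measure X, T univ = Q₂ univ →
      d ((2 : ℝ≥0∞)⁻¹ • (Q₂ + T) + Q₁) P ≤ (1 - (P B₀).toReal) / 2 := by
    intro T hT
    have hle : (1 + p) / 2 ≤ 1 := by
      rw [← NNReal.coe_le_coe] at hp1 ⊢
      push_cast at hp1 ⊢
      linarith
    have hα : 1 - (1 + p) / 2 = 2⁻¹ * (1 - p) := by
      rw [← NNReal.coe_inj, NNReal.coe_sub hle]
      push_cast [NNReal.coe_sub hp1]
      ring
    have hC : ∀ T : Measure X, T univ = Q₂ univ →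
        ((2 : ℝ≥0∞)⁻¹ • T) univ = ((1 - (1 + p) / 2 : ℝ≥0) : ℝ≥0∞) := by
      intro T hT
      rw [Measure.smul_apply, hT, m2, i2, smul_eq_mul, hα, ENNReal.coe_mul]
    have := bc_aux d h0 hadm (Q₁ + (2 : ℝ≥0∞)⁻¹ • Q₂) ((2 : ℝ≥0∞)⁻¹ • T) ((2 : ℝ≥0∞)⁻¹ • Q₂)
      ((1 + p) / 2) (by positivity) hle
      (by
        rw [Measure.add_apply, hC Q₂ rfl, m1, ← ENNReal.coe_add, ENNReal.coe_inj,
          ← NNReal.coe_inj, NNReal.coe_add, NNReal.coe_sub hle]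
        push_cast
        ring) (hC T hT) (hC Q₂ rfl)
    rw [add_assoc, add_assoc, hhalf, hsum] at this
    have e : (2 : ℝ≥0∞)⁻¹ • (Q₂ + T) + Q₁
        = Q₁ + ((2 : ℝ≥0∞)⁻¹ • Q₂ + (2 : ℝ≥0∞)⁻¹ • T) := by
      rw [smul_add, add_comm]
    rw [e]
    refine this.trans (le_of_eq ?_)
    rw [hp]
    push_cast
    rw [ENNReal.coe_toReal]
    ring
  constructor
  · rw [hQn]
    refine aux _ ?_
    rw [Measure.map_apply (hmeas n) MeasurableSet.univ, preimage_univ]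
  · have hid : ⇑(g⁻¹ ^ n) ∘ ⇑(g ^ n) = id := by
      funext x
      simp
    rw [hQn, Measure.map_add _ _ (hmeas' n), hinv, Measure.map_smul,
      Measure.map_add _ _ (hmeas' n), Measure.map_map (hmeas' n) (hmeas n), hid, Measure.map_id,
      add_comm (Measure.map _ Q₂)]
    refine aux _ ?_
    rw [Measure.map_apply (hmeas' n) MeasurableSet.univ, preimage_univ]
end

section
/- Let 𝒫 be the set of probability measures on ℝ^k and let T : 𝒫 → ℝ^k be translation equivariant, i.e. T(P^{τ_a}) = T(P) + a for every a ∈ ℝ^k, where τ_a(x) = x + a and P^{τ_a} is the pushforward of P under τ_a. Then for every P ∈ 𝒫 and every admissible pseudometric d, ε*(T, P, d, D) ≤ 1/2, where D is the Euclidean metric on ℝ^k. -/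
open MeasureTheory Filter Set
open scoped NNReal ENNReal

/-- **Davies–Gather, Section 4.1:** every translation equivariant location functional
on the probability measures on `ℝᵏ` has breakdown point at most `1/2`, for every
admissible pseudometric `d`, the metric `D` on `ℝᵏ` being the Euclidean one. -/
theorem location_breakdown_le_half
    (k : ℕ)
    -- an admissible pseudometric `d` on the probability measures on `ℝᵏ`
    (d : Measure (EuclideanSpace ℝ (Fin k)) → Measure (EuclideanSpace ℝ (Fin k)) → ℝ)
    (hd_self : ∀ P, IsProbabilityMeasure P → d P P = 0)
    (hd_nonneg : ∀ P Q, IsProbabilityMeasure P → IsProbabilityMeasure Q → 0 ≤ d P Q)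
    (hd_symm : ∀ P Q, IsProbabilityMeasure P → IsProbabilityMeasure Q → d P Q = d Q P)
    (hd_tri : ∀ P Q R, IsProbabilityMeasure P → IsProbabilityMeasure Q →
      IsProbabilityMeasure R → d P R ≤ d P Q + d Q R)
    (hd_sup_one : IsLUB {r : ℝ | ∃ P Q : Measure (EuclideanSpace ℝ (Fin k)),
      IsProbabilityMeasure P ∧ IsProbabilityMeasure Q ∧ r = d P Q} 1)
    (hd_convex : ∀ (P Q₁ Q₂ : Measure (EuclideanSpace ℝ (Fin k))), IsProbabilityMeasure P →
      IsProbabilityMeasure Q₁ → IsProbabilityMeasure Q₂ → ∀ α : ℝ≥0, 0 < α → α < 1 →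
      d ((α : ℝ≥0∞) • P + ((1 - α : ℝ≥0) : ℝ≥0∞) • Q₁)
        ((α : ℝ≥0∞) • P + ((1 - α : ℝ≥0) : ℝ≥0∞) • Q₂) ≤ 1 - (α : ℝ))
    -- a translation equivariant functional `T`
    (T : Measure (EuclideanSpace ℝ (Fin k)) → EuclideanSpace ℝ (Fin k))
    (hT_equiv : ∀ (P : Measure (EuclideanSpace ℝ (Fin k))), IsProbabilityMeasure P →
      ∀ a : EuclideanSpace ℝ (Fin k), T (Measure.map (fun x => x + a) P) = T P + a)
    (P : Measure (EuclideanSpace ℝ (Fin k))) (hP : IsProbabilityMeasure P) :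
    sInf {ε : ℝ | 0 < ε ∧ ∀ M : ℝ, ∃ Q : Measure (EuclideanSpace ℝ (Fin k)),
        IsProbabilityMeasure Q ∧ d P Q < ε ∧ M < dist (T P) (T Q)} ≤ 1 / 2 := by
  rcases Nat.eq_zero_or_pos k with hk | hk
  · subst hk
    have hempty : {ε : ℝ | 0 < ε ∧ ∀ M : ℝ, ∃ Q : Measure (EuclideanSpace ℝ (Fin 0)),
        IsProbabilityMeasure Q ∧ d P Q < ε ∧ M < dist (T P) (T Q)} = ∅ := by
      ext ε
      simp only [Set.mem_setOf_eq, Set.mem_empty_iff_false, iff_false]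
      rintro ⟨_, h⟩
      obtain ⟨Q, _, _, h⟩ := h 0
      rw [Subsingleton.elim (T P) (T Q), dist_self] at h
      exact lt_irrefl _ h
    rw [hempty, Real.sInf_empty]
    norm_num
  haveI : Nonempty (Fin k) := ⟨⟨0, hk⟩⟩
  refine le_of_forall_gt_imp_ge_of_dense fun ε hε => ?_
  refine csInf_le ⟨0, fun x hx => hx.1.le⟩ ⟨by linarith, fun M => ?_⟩
  obtain ⟨a, ha⟩ := NormedSpace.exists_lt_norm ℝ (EuclideanSpace ℝ (Fin k)) (2 * M)
  have hmap : ∀ b : EuclideanSpace ℝ (Fin k),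
      IsProbabilityMeasure (Measure.map (fun x => x + b) P) := fun b =>
    Measure.isProbabilityMeasure_map (by fun_prop)
  have h12 : (1 - 1 / 2 : ℝ≥0) = 1 / 2 := by
    apply tsub_eq_of_eq_add
    norm_num
  have hsum : (((1 / 2 : ℝ≥0) : ℝ≥0∞)) + ((1 / 2 : ℝ≥0) : ℝ≥0∞) = 1 := by
    rw [← ENNReal.coe_add, add_halves, ENNReal.coe_one]
  have hPP : ((1 / 2 : ℝ≥0) : ℝ≥0∞) • P + ((1 / 2 : ℝ≥0) : ℝ≥0∞) • P = P := by
    rw [← add_smul, hsum, one_smul]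
  have hprob : ∀ R : Measure (EuclideanSpace ℝ (Fin k)), IsProbabilityMeasure R →
      IsProbabilityMeasure
        (((1 / 2 : ℝ≥0) : ℝ≥0∞) • P + ((1 / 2 : ℝ≥0) : ℝ≥0∞) • R) := by
    intro R hR
    constructor
    rw [Measure.add_apply, Measure.smul_apply, Measure.smul_apply, measure_univ, measure_univ,
      smul_eq_mul, mul_one, hsum]
  have hdist : ∀ R : Measure (EuclideanSpace ℝ (Fin k)), IsProbabilityMeasure R →
      d P (((1 / 2 : ℝ≥0) : ℝ≥0∞) • P + ((1 / 2 : ℝ≥0) : ℝ≥0∞) • R) < ε := by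
    intro R hR
    have h := hd_convex P P R hP hP hR (1 / 2) (by norm_num) (by
      rw [← NNReal.coe_lt_coe]; norm_num)
    rw [h12, hPP] at h
    refine lt_of_le_of_lt h ?_
    push_cast
    linarith
  have hT := hT_equiv _ (hprob _ (hmap a)) (-a)
  have hm : Measurable (fun x : EuclideanSpace ℝ (Fin k) => x + -a) := by fun_prop
  have hm' : Measurable (fun x : EuclideanSpace ℝ (Fin k) => x + a) := by fun_prop
  have hback : Measure.map (fun x => x + -a) (Measure.map (fun x => x + a) P) = P := by
    rw [Measure.map_map hm hm']
    have : ((fun x : EuclideanSpace ℝ (Fin k) => x + -a) ∘ fun x => x + a) = id := by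
      ext1 x; simp
    rw [this, Measure.map_id]
  rw [Measure.map_add _ _ hm, Measure.map_smul, Measure.map_smul, hback, add_comm] at hT
  by_cases h : M < dist (T P)
      (T (((1 / 2 : ℝ≥0) : ℝ≥0∞) • P + ((1 / 2 : ℝ≥0) : ℝ≥0∞) • Measure.map (fun x => x + a) P))
  · exact ⟨_, hprob _ (hmap a), hdist _ (hmap a), h⟩
  · refine ⟨_, hprob _ (hmap (-a)), hdist _ (hmap (-a)), ?_⟩
    rw [hT]
    generalize T (((1 / 2 : ℝ≥0) : ℝ≥0∞) • P +
      ((1 / 2 : ℝ≥0) : ℝ≥0∞) • Measure.map (fun x => x + a) P) = t at h ⊢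
    have h1 : dist t (t + -a) = ‖a‖ := by simp [dist_eq_norm]
    have h2 := dist_triangle_left t (t + -a) (T P)
    linarith [not_lt.mp h]
end

section
/- Let Θ = (0, ∞)² with pseudometric D((a₁, c₁), (a₂, c₂)) = |a₁ − a₂| + |1/a₁ − 1/a₂| + |c₁ − c₂|, and for α > 0 define h_α(a, c) = (a/√α, c/√α), so that h_α applied n times equals h_{αⁿ}. Then for every α > 0 with α ≠ 1, lim_{n→∞} inf_{(a,c) ∈ (0,∞)²} D((a, c), h_{αⁿ}(a, c)) = ∞. -/
open Filter

lemma mm_key (t a : ℝ) (ht : 0 < t) (ha : 0 < a) :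
    |t - t⁻¹| ≤ |a - a / t ^ 2| + |1 / a - 1 / (a / t ^ 2)| := by
  have h1 : a - a / t ^ 2 = (a / t) * (t - t⁻¹) := by field_simp
  have h2 : 1 / a - 1 / (a / t ^ 2) = -((t / a) * (t - t⁻¹)) := by field_simp; ring
  rw [h1, h2, abs_neg, abs_mul, abs_mul, abs_of_pos (div_pos ha ht), abs_of_pos (div_pos ht ha),
    ← add_mul]
  have h3 : 1 ≤ a / t + t / a := by
    rw [div_add_div _ _ ht.ne' ha.ne', le_div_iff₀ (mul_pos ht ha)]
    nlinarith [sq_nonneg (a - t), mul_pos ht ha]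
  nlinarith [abs_nonneg (t - t⁻¹)]

/-- **Davies–Gather, Section 4.5 (Michaelis–Menten model):** on `Θ = (0,∞)²` with
pseudometric `D((a₁,c₁),(a₂,c₂)) = |a₁−a₂| + |1/a₁−1/a₂| + |c₁−c₂|` and the rescaling
action `h_α(a,c) = (a/√α, c/√α)`, for every `α > 0` with `α ≠ 1` the infimum over
`Θ` of `D(θ, h_{αⁿ}(θ))` tends to `∞` with `n`. -/
theorem michaelis_menten_G1
    (α : ℝ) (hα : 0 < α) (hα1 : α ≠ 1) :
    Tendsto (fun n : ℕ =>
        ⨅ p : {q : ℝ × ℝ // 0 < q.1 ∧ 0 < q.2},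
          |(p : ℝ × ℝ).1 - (p : ℝ × ℝ).1 / Real.sqrt (α ^ n)| +
          |1 / (p : ℝ × ℝ).1 - 1 / ((p : ℝ × ℝ).1 / Real.sqrt (α ^ n))| +
          |(p : ℝ × ℝ).2 - (p : ℝ × ℝ).2 / Real.sqrt (α ^ n)|)
      atTop atTop := by
  set r := Real.sqrt (Real.sqrt α) with hr
  have hr0 : 0 < r := Real.sqrt_pos.2 (Real.sqrt_pos.2 hα)
  have hr4 : r ^ 4 = α := by
    have : r ^ 4 = (r ^ 2) ^ 2 := by ring
    rw [this, hr, Real.sq_sqrt (Real.sqrt_nonneg _), Real.sq_sqrt hα.le]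
  have hs : ∀ n : ℕ, Real.sqrt (α ^ n) = (r ^ n) ^ 2 := by
    intro n
    rw [← hr4, show (r ^ 4) ^ n = ((r ^ n) ^ 2) ^ 2 by ring, Real.sqrt_sq (by positivity)]
  have hr1 : r ≠ 1 := by
    intro h
    rw [h] at hr4
    exact hα1 (by rw [← hr4]; norm_num)
  have : Nonempty {q : ℝ × ℝ // 0 < q.1 ∧ 0 < q.2} := ⟨⟨(1, 1), by norm_num⟩⟩
  have hT : Tendsto (fun n : ℕ => |r ^ n - (r ^ n)⁻¹|) atTop atTop := by
    rcases lt_or_gt_of_ne hr1 with h | h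
    · have h' := tendsto_atTop_add_const_right atTop (-1 : ℝ)
        (tendsto_pow_atTop_atTop_of_one_lt ((one_lt_inv₀ hr0).2 h))
      refine tendsto_atTop_mono (fun n => ?_) h'
      have := pow_le_one₀ (n := n) hr0.le h.le
      rw [inv_pow]
      have := neg_abs_le (r ^ n - (r ^ n)⁻¹)
      linarith
    · have h' := tendsto_atTop_add_const_right atTop (-1 : ℝ)
        (tendsto_pow_atTop_atTop_of_one_lt h)
      refine tendsto_atTop_mono (fun n => ?_) h'
      have := inv_le_one_of_one_le₀ (one_le_pow₀ (n := n) h.le)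
      have := le_abs_self (r ^ n - (r ^ n)⁻¹)
      linarith
  refine tendsto_atTop_mono (fun n => ?_) hT
  refine le_ciInf (fun p => ?_)
  rw [hs n]
  have := mm_key (r ^ n) (p : ℝ × ℝ).1 (pow_pos hr0 n) p.2.1
  exact this.trans (le_add_of_nonneg_right (abs_nonneg _))
end

section
/- Let ε > 0, n > k ≥ 1, and let x₁, …, x_n ∈ ℝ^k be such that every k+1 of the vectors (1, x_i^t) ∈ ℝ^{k+1} are linearly independent. Then there exists C < ∞ with the following property: for every sample ((y₁, z₁), …, (y_n, z_n)) ∈ ({0,1} × ℝ^k)ⁿ for which z_j = x_j for at least k+1 indices j, every minimizer θ = (θ₀, θ̃) ∈ ℝ^{k+1} of L(θ) = (1/n) Σ_{j=1}^n [ (y_j − exp(θ₀ + z_j^t θ̃)/(1 + exp(θ₀ + z_j^t θ̃)))² + ε(θ₀ + z_j^t θ̃)² ] satisfies ‖θ‖ ≤ C. -/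
open scoped RealInnerProductSpace

theorem aux_bound (k n : ℕ) (x : Fin n → EuclideanSpace ℝ (Fin k)) (s : Finset (Fin n))
    (hs : s.card = k + 1)
    (h : LinearIndependent ℝ
      (fun i : s => ((1 : ℝ), x i) : s → ℝ × EuclideanSpace ℝ (Fin k))) (M : ℝ) (hM : 0 ≤ M) :
    ∃ C : ℝ, 0 ≤ C ∧ ∀ θ : ℝ × EuclideanSpace ℝ (Fin k),
      (∀ i ∈ s, |θ.1 + ⟪x i, θ.2⟫| ≤ M) → ‖θ‖ ≤ C := by
  let T : (ℝ × EuclideanSpace ℝ (Fin k)) →ₗ[ℝ] (s → ℝ) :=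
    { toFun := fun θ i => θ.1 + ⟪x i, θ.2⟫
      map_add' := by
        intro a b; ext i
        simp [inner_add_right]; ring
      map_smul' := by
        intro c a; ext i
        simp [inner_smul_right]; ring }
  have hspan := h.span_eq_top_of_card_eq_finrank' (by simp [hs, add_comm])
  have hker : LinearMap.ker T = ⊥ := by
    rw [LinearMap.ker_eq_bot']
    intro θ hθ
    let l : (ℝ × EuclideanSpace ℝ (Fin k)) →ₗ[ℝ] ℝ :=
      { toFun := fun v => θ.1 * v.1 + ⟪v.2, θ.2⟫
        map_add' := by
          intro a b
          simp [inner_add_left]; ring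
        map_smul' := by
          intro c a
          simp [inner_smul_left]; ring }
    have hl : l = 0 := by
      apply LinearMap.ext_on_range hspan
      intro i
      have := congrFun hθ i
      simpa [l, T] using this
    have h0 : θ.1 * θ.1 + ⟪θ.2, θ.2⟫ = 0 := by
      have := LinearMap.congr_fun hl θ
      exact this
    rw [real_inner_self_eq_norm_sq] at h0
    have h1 : θ.1 = 0 := by nlinarith [sq_nonneg ‖θ.2‖, mul_self_nonneg θ.1]
    have h2 : ‖θ.2‖ = 0 := by
      rw [h1] at h0
      simpa using h0
    exact Prod.ext h1 (norm_eq_zero.1 h2)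
  obtain ⟨K, -, hK⟩ := T.exists_antilipschitzWith hker
  refine ⟨K * M, by positivity, fun θ hθ => ?_⟩
  have h1 : ‖T θ‖ ≤ M := by
    rw [pi_norm_le_iff_of_nonneg hM]
    intro i
    exact hθ i i.2
  have h2 := hK.le_mul_dist θ 0
  rw [map_zero, dist_zero_right, dist_zero_right] at h2
  exact h2.trans (mul_le_mul_of_nonneg_left h1 K.2)

/-- **Davies–Gather, Section 4.6 (logistic regression I):** if every `k+1` of the
vectors `(1, xᵢᵗ)` are linearly independent, then the minimizers of the regularized
least-squares logistic objective are uniformly bounded over all replacement samples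
retaining at least `k+1` of the original covariates; hence the finite-sample
breakdown point of the functional is `1 − k/n`. -/
theorem logistic_regularized_bounded
    (ε : ℝ) (hε : 0 < ε) (k n : ℕ) (hkn : k < n) (hk : 1 ≤ k)
    (x : Fin n → EuclideanSpace ℝ (Fin k))
    (hx : ∀ s : Finset (Fin n), s.card = k + 1 →
      LinearIndependent ℝ (fun i : s => ((1 : ℝ), x i) : s → ℝ × EuclideanSpace ℝ (Fin k))) :
    ∃ C : ℝ, ∀ (y : Fin n → ℝ) (z : Fin n → EuclideanSpace ℝ (Fin k)),
      (∀ j, y j = 0 ∨ y j = 1) →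
      k + 1 ≤ {j | z j = x j}.ncard →
      ∀ θ : ℝ × EuclideanSpace ℝ (Fin k),
        (∀ θ' : ℝ × EuclideanSpace ℝ (Fin k),
          (1 / (n : ℝ)) * ∑ j : Fin n,
            ((y j - Real.exp (θ.1 + ⟪z j, θ.2⟫) / (1 + Real.exp (θ.1 + ⟪z j, θ.2⟫))) ^ 2 +
              ε * (θ.1 + ⟪z j, θ.2⟫) ^ 2) ≤
          (1 / (n : ℝ)) * ∑ j : Fin n,
            ((y j - Real.exp (θ'.1 + ⟪z j, θ'.2⟫) / (1 + Real.exp (θ'.1 + ⟪z j, θ'.2⟫))) ^ 2 +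
              ε * (θ'.1 + ⟪z j, θ'.2⟫) ^ 2)) →
        ‖θ‖ ≤ C := by
  have hn : (0 : ℝ) < n := by exact_mod_cast (by omega : 0 < n)
  have hM : (0 : ℝ) ≤ √(n / (4 * ε)) := Real.sqrt_nonneg _
  have key : ∀ s : Finset (Fin n), ∃ C : ℝ, 0 ≤ C ∧ (s.card = k + 1 →
      ∀ θ : ℝ × EuclideanSpace ℝ (Fin k),
      (∀ i ∈ s, |θ.1 + ⟪x i, θ.2⟫| ≤ √(n / (4 * ε))) → ‖θ‖ ≤ C) := by
    intro s
    by_cases hs : s.card = k + 1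
    · obtain ⟨C, h0, h⟩ := aux_bound k n x s hs (hx s hs) _ hM
      exact ⟨C, h0, fun _ => h⟩
    · exact ⟨0, le_rfl, fun h => absurd h hs⟩
  choose C hC0 hC using key
  refine ⟨∑ s, C s, ?_⟩
  intro y z hy hz θ hmin
  have hle := le_of_mul_le_mul_left (hmin 0) (by positivity)
  have hR : ∑ j : Fin n, ((y j - Real.exp ((0 : ℝ × EuclideanSpace ℝ (Fin k)).1 +
      ⟪z j, (0 : ℝ × EuclideanSpace ℝ (Fin k)).2⟫) /
      (1 + Real.exp ((0 : ℝ × EuclideanSpace ℝ (Fin k)).1 +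
      ⟪z j, (0 : ℝ × EuclideanSpace ℝ (Fin k)).2⟫))) ^ 2 +
      ε * ((0 : ℝ × EuclideanSpace ℝ (Fin k)).1 +
      ⟪z j, (0 : ℝ × EuclideanSpace ℝ (Fin k)).2⟫) ^ 2) = (n : ℝ) / 4 := by
    have : ∀ j : Fin n, ((y j - Real.exp ((0 : ℝ × EuclideanSpace ℝ (Fin k)).1 +
      ⟪z j, (0 : ℝ × EuclideanSpace ℝ (Fin k)).2⟫) /
      (1 + Real.exp ((0 : ℝ × EuclideanSpace ℝ (Fin k)).1 +
      ⟪z j, (0 : ℝ × EuclideanSpace ℝ (Fin k)).2⟫))) ^ 2 +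
      ε * ((0 : ℝ × EuclideanSpace ℝ (Fin k)).1 +
      ⟪z j, (0 : ℝ × EuclideanSpace ℝ (Fin k)).2⟫) ^ 2) = 1 / 4 := by
      intro j
      simp only [Prod.fst_zero, Prod.snd_zero, inner_zero_right, add_zero, Real.exp_zero]
      rcases hy j with h | h <;> rw [h] <;> norm_num
    rw [Finset.sum_congr rfl (fun j _ => this j)]
    rw [Finset.sum_const, Finset.card_univ, Fintype.card_fin, nsmul_eq_mul]; ring
  rw [hR] at hle
  have hb : ∀ j, |θ.1 + ⟪z j, θ.2⟫| ≤ √(n / (4 * ε)) := by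
    intro j
    apply Real.abs_le_sqrt
    have h1 := (Finset.single_le_sum (fun i _ => by positivity) (Finset.mem_univ j)).trans hle
    have h2 := sq_nonneg (y j - Real.exp (θ.1 + ⟪z j, θ.2⟫) / (1 + Real.exp (θ.1 + ⟪z j, θ.2⟫)))
    rw [le_div_iff₀ (by positivity)]
    linarith
  rw [Set.ncard_eq_toFinset_card'] at hz
  obtain ⟨s, hs, hcard⟩ := Finset.exists_subset_card_eq hz
  refine (hC s hcard θ fun i hi => ?_).trans
    (Finset.single_le_sum (fun s _ => hC0 s) (Finset.mem_univ s))
  have : z i = x i := by simpa using hs hi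
  rw [← this]
  exact hb i
end

section
/- Let x₁, …, x_n ∈ ℝ and define the (lower) median of a sample y = (y₁, …, y_n) by med(y) = inf{t ∈ ℝ : #{i : y_i ≤ t} ≥ n/2}. Then for every sample y differing from (x₁, …, x_n) in at most ⌊(n−1)/2⌋ coordinates, min_i x_i ≤ med(y) ≤ max_i x_i. (Thus the median attains the finite-sample breakdown point ⌊(n+1)/2⌋/n for translation equivariant functionals on ℝ.) -/
open Set

/-- **Davies–Gather, Section 5.1 / Section 6:** the (lower) sample median
`med(y) = inf{t : #{i : yᵢ ≤ t} ≥ n/2}` stays between the minimum and the maximum of the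
original sample under replacement of at most `⌊(n−1)/2⌋` points; thus the median attains
the finite-sample breakdown point `⌊(n+1)/2⌋/n` for translation equivariant functionals. -/
theorem median_bounded
    (n : ℕ) (hn : 0 < n) (x : Fin n → ℝ) :
    ∀ y : Fin n → ℝ,
      {i | y i ≠ x i}.ncard ≤ (n - 1) / 2 →
      Finset.univ.inf' (Finset.univ_nonempty_iff.mpr (Fin.pos_iff_nonempty.mp hn)) x ≤
          sInf {t : ℝ | (n : ℝ) / 2 ≤ {i | y i ≤ t}.ncard} ∧
        sInf {t : ℝ | (n : ℝ) / 2 ≤ {i | y i ≤ t}.ncard} ≤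
          Finset.univ.sup' (Finset.univ_nonempty_iff.mpr (Fin.pos_iff_nonempty.mp hn)) x := by
  intro y hy
  have hne : (Finset.univ : Finset (Fin n)).Nonempty :=
    Finset.univ_nonempty_iff.mpr (Fin.pos_iff_nonempty.mp hn)
  have lower : ∀ t ∈ {t : ℝ | (n : ℝ) / 2 ≤ {i | y i ≤ t}.ncard},
      Finset.univ.inf' hne x ≤ t := by
    intro t ht
    by_contra hlt
    push Not at hlt
    have hsub : {i | y i ≤ t} ⊆ {i | y i ≠ x i} := by
      intro i hi heq
      have h1 : Finset.univ.inf' hne x ≤ x i := Finset.inf'_le x (Finset.mem_univ i)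
      have h2 : y i ≤ t := hi
      linarith
    have hc := Set.ncard_le_ncard hsub (Set.toFinite _)
    have ht' : (n : ℝ) / 2 ≤ ({i | y i ≤ t}.ncard : ℝ) := ht
    have h3 : (n : ℝ) ≤ ((2 * {i | y i ≤ t}.ncard : ℕ) : ℝ) := by
      push_cast
      linarith
    have h4 := Nat.cast_le.mp h3
    omega
  have upper : Finset.univ.sup' hne x ∈
      {t : ℝ | (n : ℝ) / 2 ≤ {i | y i ≤ t}.ncard} := by
    have hsub : {i | y i ≠ x i}ᶜ ⊆ {i | y i ≤ Finset.univ.sup' hne x} := by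
      intro i hi
      have h1 : x i ≤ Finset.univ.sup' hne x := Finset.le_sup' x (Finset.mem_univ i)
      have h2 : y i = x i := not_not.mp hi
      show y i ≤ _
      linarith
    have hc := Set.ncard_le_ncard hsub (Set.toFinite _)
    have hadd := Set.ncard_add_ncard_compl {i | y i ≠ x i}
    rw [Nat.card_eq_fintype_card, Fintype.card_fin] at hadd
    have h4 : n ≤ 2 * {i | y i ≤ Finset.univ.sup' hne x}.ncard := by omega
    have h5 : (n : ℝ) ≤ ((2 * {i | y i ≤ Finset.univ.sup' hne x}.ncard : ℕ) : ℝ) :=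
      Nat.cast_le.mpr h4
    push_cast at h5
    show (n : ℝ) / 2 ≤ _
    linarith
  exact ⟨le_csInf ⟨_, upper⟩ lower, csInf_le ⟨_, lower⟩ upper⟩
end

section
/- Let T be a functional defined on empirical measures of samples of size n in (0,∞) × ℝ, with values in Θ = (0,∞)², which is equivariant for the Michaelis–Menten group: for every α > 0, T applied to the empirical measure of ((αx₁, y₁), …, (αx_n, y_n)) equals h_α(T(P_n)) where h_α(a, c) = (a/√α, c/√α). Then for every sample, with k = ⌊(n+1)/2⌋, sup over k-replacement samples y of D(T(P_n), T(Q_y)) = ∞, where D((a₁, c₁), (a₂, c₂)) = |a₁ − a₂| + |1/a₁ − 1/a₂| + |c₁ − c₂|; i.e. fsbp(T, x_n, D) ≤ ⌊(n+1)/2⌋/n. -/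
open MeasureTheory Set Filter
open scoped NNReal ENNReal

/-- The pseudometric on the Michaelis–Menten parameter space `Θ = (0,∞)²`. -/
noncomputable def mmDist (θ₁ θ₂ : ℝ × ℝ) : ℝ :=
  |θ₁.1 - θ₂.1| + |1 / θ₁.1 - 1 / θ₂.1| + |θ₁.2 - θ₂.2|

/-- **Davies–Gather, Section 4.5 (Michaelis–Menten model, finite-sample version):**
every functional `T` on samples in `(0,∞) × ℝ` with values in `Θ = (0,∞)²` that is
equivariant under the rescaling group `x ↦ αx`, `h_α(a,c) = (a/√α, c/√α)`, breaks down
after `⌊(n+1)/2⌋` replacements; i.e. `fsbp(T, xₙ, D) ≤ ⌊(n+1)/2⌋/n`. -/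
theorem michaelis_menten_fsbp_le
    (n : ℕ) (hn : 0 < n)
    (T : Measure (ℝ × ℝ) → ℝ × ℝ)
    (hT_pos : ∀ x : Fin n → ℝ × ℝ, (∀ i, 0 < (x i).1) →
      0 < (T (empiricalMeasure x)).1 ∧ 0 < (T (empiricalMeasure x)).2)
    (hT_equiv : ∀ (x : Fin n → ℝ × ℝ), (∀ i, 0 < (x i).1) → ∀ α : ℝ, 0 < α →
      T (empiricalMeasure (fun i => (α * (x i).1, (x i).2))) =
        ((T (empiricalMeasure x)).1 / Real.sqrt α, (T (empiricalMeasure x)).2 / Real.sqrt α))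
    (x : Fin n → ℝ × ℝ) (hx : ∀ i, 0 < (x i).1) :
    (∀ M : ℝ, ∃ y : Fin n → ℝ × ℝ, (∀ i, 0 < (y i).1) ∧
      {i | y i ≠ x i}.ncard ≤ (n + 1) / 2 ∧
      M < mmDist (T (empiricalMeasure x)) (T (empiricalMeasure y))) ∧
    ((sInf {m : ℕ | ∀ M : ℝ, ∃ y : Fin n → ℝ × ℝ, (∀ i, 0 < (y i).1) ∧
        {i | y i ≠ x i}.ncard ≤ m ∧
        M < mmDist (T (empiricalMeasure x)) (T (empiricalMeasure y))} : ℕ) : ℝ) / n ≤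
      (((n + 1) / 2 : ℕ) : ℝ) / n := by
  have key : ∀ M : ℝ, ∃ y : Fin n → ℝ × ℝ, (∀ i, 0 < (y i).1) ∧
      {i | y i ≠ x i}.ncard ≤ (n + 1) / 2 ∧
      M < mmDist (T (empiricalMeasure x)) (T (empiricalMeasure y)) := by
    intro M
    by_contra! hcon
    obtain ⟨ha, -⟩ := hT_pos x hx
    set θ := T (empiricalMeasure x) with hθ
    set K := |M| with hK
    have hK0 : 0 ≤ K := abs_nonneg M
    have hMK : M ≤ K := le_abs_self M
    set s : ℝ := (θ.1 + K) * (1 / θ.1 + K) + 1 with hs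
    have hspos : 0 < s := by positivity
    have hs2 : 0 < s ^ 2 := by positivity
    let z : Fin n → ℝ × ℝ := fun i =>
      if (i : ℕ) < (n + 1) / 2 then x i else ((s ^ 2)⁻¹ * (x i).1, (x i).2)
    let y : Fin n → ℝ × ℝ := fun i => (s ^ 2 * (z i).1, (z i).2)
    have hz : ∀ i, 0 < (z i).1 := by
      intro i
      have := hx i
      by_cases h : (i : ℕ) < (n + 1) / 2
      · simpa [z, h] using this
      · simp only [z, h, if_false]
        positivity
    have hy : ∀ i, 0 < (y i).1 := fun i => mul_pos hs2 (hz i)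
    have cz : {i | z i ≠ x i}.ncard ≤ (n + 1) / 2 := by
      have hsub : (fun i : Fin n => (i : ℕ)) '' {i | z i ≠ x i}
          ⊆ (Finset.Ico ((n + 1) / 2) n : Finset ℕ) := by
        rintro _ ⟨i, hi, rfl⟩
        have h : ¬ (i : ℕ) < (n + 1) / 2 := fun h => hi (by simp [z, h])
        simp only [Finset.coe_Ico, Set.mem_Ico]
        exact ⟨not_lt.mp h, i.2⟩
      have h1 := Set.ncard_le_ncard hsub (Finset.finite_toSet _)
      rw [Set.ncard_image_of_injective _ Fin.val_injective, Set.ncard_coe_finset,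
        Nat.card_Ico] at h1
      omega
    have cy : {i | y i ≠ x i}.ncard ≤ (n + 1) / 2 := by
      have hsub : (fun i : Fin n => (i : ℕ)) '' {i | y i ≠ x i}
          ⊆ (Finset.range ((n + 1) / 2) : Finset ℕ) := by
        rintro _ ⟨i, hi, rfl⟩
        simp only [Finset.coe_range, Set.mem_Iio]
        by_contra h
        apply hi
        simp only [y, z, h, if_false]
        rw [mul_inv_cancel_left₀ hs2.ne']
      have h1 := Set.ncard_le_ncard hsub (Finset.finite_toSet _)
      rwa [Set.ncard_image_of_injective _ Fin.val_injective, Set.ncard_coe_finset,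
        Finset.card_range] at h1
    have dz := hcon z hz cz
    have dy := hcon y hy cy
    have e := hT_equiv z hz (s ^ 2) hs2
    rw [Real.sqrt_sq hspos.le] at e
    change T (empiricalMeasure y) = _ at e
    rw [e] at dy
    obtain ⟨hb, -⟩ := hT_pos z hz
    set φ := T (empiricalMeasure z) with hφ
    simp only [mmDist] at dz dy
    have b1 : φ.1 ≤ θ.1 + K := by
      have := neg_abs_le (θ.1 - φ.1)
      have := abs_nonneg (1 / θ.1 - 1 / φ.1)
      have := abs_nonneg (θ.2 - φ.2)
      linarith
    have b2 : s / φ.1 ≤ 1 / θ.1 + K := by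
      rw [one_div_div] at dy
      have := neg_abs_le (1 / θ.1 - s / φ.1)
      have := abs_nonneg (θ.1 - φ.1 / s)
      have := abs_nonneg (θ.2 - φ.2 / s)
      linarith
    rw [div_le_iff₀ hb] at b2
    have h0 : 0 ≤ 1 / θ.1 + K := by positivity
    have := mul_le_mul_of_nonneg_left b1 h0
    linarith
  refine ⟨key, ?_⟩
  gcongr
  exact Nat.sInf_le key
end
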